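/- arXiv:0710.4579 — 3 statements merged into one kernel-verified Lean document; each statement's English description precedes it below -/
import Mathlib

section
/- Let d ≥ 1, let K ⊂ ℝ^d be a compact convex set equipped with Lebesgue measure λ, and let H : ℝ^d → [0, ∞] be a measurable function. Then ∫_{K×K} (∫₀¹ H((1−s)x₁ + s x₂) ds) d(λ×λ)(x₁, x₂) ≤ 2^d · λ(K) · ∫_K H dλ. -/
open MeasureTheory
open scoped ENNReal

open Module in
/-- Contracting a measurable set into itself by an affine map of ratio `a ≥ 1 / 2` changes the
integral of a nonnegative function by a factor of at most `2 ^ finrank ℝ E`. -/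
theorem setLIntegral_comp_smul_add_le {E : Type*} [NormedAddCommGroup E] [NormedSpace ℝ E]
    [MeasurableSpace E] [BorelSpace E] [FiniteDimensional ℝ E] (μ : Measure E)
    [μ.IsAddHaarMeasure] {K : Set E} (hK : MeasurableSet K) {H : E → ℝ≥0∞} (hH : Measurable H)
    {a : ℝ} (ha : 1 / 2 ≤ a) {z : E} (hz : ∀ x ∈ K, a • x + z ∈ K) :
    ∫⁻ x in K, H (a • x + z) ∂μ ≤ 2 ^ finrank ℝ E * ∫⁻ y in K, H y ∂μ := by
  have ha0 : 0 < a := by linarith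
  have hG : Measurable (K.indicator H) := hH.indicator hK
  have hfactor : ENNReal.ofReal |(a ^ finrank ℝ E)⁻¹| ≤ 2 ^ finrank ℝ E := by
    rw [abs_of_pos (by positivity), ← inv_pow, ENNReal.ofReal_pow (by positivity)]
    gcongr
    refine ENNReal.ofReal_le_of_le_toReal ?_
    rw [ENNReal.toReal_ofNat]
    exact inv_le_of_inv_le₀ two_pos (by linarith)
  calc ∫⁻ x in K, H (a • x + z) ∂μ
      = ∫⁻ x in K, K.indicator H (a • x + z) ∂μ :=
        setLIntegral_congr_fun hK fun x hx => (Set.indicator_of_mem (hz x hx) H).symm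
    _ ≤ ∫⁻ x, K.indicator H (a • x + z) ∂μ := setLIntegral_le_lintegral _ _
    _ = ∫⁻ y, K.indicator H (y + z) ∂(μ.map (a • ·)) :=
        (lintegral_map (hG.comp (measurable_add_const z)) (measurable_const_smul a)).symm
    _ = ENNReal.ofReal |(a ^ finrank ℝ E)⁻¹| * ∫⁻ y in K, H y ∂μ := by
        rw [Measure.map_addHaar_smul μ ha0.ne', lintegral_smul_measure, smul_eq_mul,
          lintegral_add_right_eq_self, lintegral_indicator hK]
    _ ≤ 2 ^ finrank ℝ E * ∫⁻ y in K, H y ∂μ := by gcongr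

open Module in
/-- For a fixed `s ∈ [0, 1]`, the integral of `H ((1 - s) x₁ + s x₂)` over pairs of points of a
convex set `K` is at most `2 ^ finrank ℝ E * μ K * ∫_K H`. -/
theorem Convex.setLIntegral_prod_comp_segment_le {E : Type*} [NormedAddCommGroup E]
    [NormedSpace ℝ E] [MeasurableSpace E] [BorelSpace E] [FiniteDimensional ℝ E] (μ : Measure E)
    [μ.IsAddHaarMeasure] {K : Set E} (hconv : Convex ℝ K) (hK : MeasurableSet K)
    {H : E → ℝ≥0∞} (hH : Measurable H) {s : ℝ} (hs : s ∈ Set.Icc (0 : ℝ) 1) :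
    ∫⁻ p in K ×ˢ K, H ((1 - s) • p.1 + s • p.2) ∂(μ.prod μ)
      ≤ 2 ^ finrank ℝ E * μ K * ∫⁻ y in K, H y ∂μ := by
  have hmeas : Measurable fun p : E × E => H ((1 - s) • p.1 + s • p.2) :=
    hH.comp (by fun_prop)
  have hmem {x y : E} (hx : x ∈ K) (hy : y ∈ K) : (1 - s) • x + s • y ∈ K :=
    hconv hx hy (by linarith [hs.2]) hs.1 (by ring)
  have hconst : ∫⁻ _ in K, 2 ^ finrank ℝ E * ∫⁻ y in K, H y ∂μ ∂μ
      = 2 ^ finrank ℝ E * μ K * ∫⁻ y in K, H y ∂μ := by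
    rw [setLIntegral_const]
    ring
  rcases le_total s (1 / 2) with h | h
  · rw [setLIntegral_prod_symm _ hmeas.aemeasurable, ← hconst]
    exact setLIntegral_mono' hK fun y hy =>
      setLIntegral_comp_smul_add_le μ hK hH (by linarith) fun x hx => hmem hx hy
  · rw [setLIntegral_prod _ hmeas.aemeasurable, ← hconst]
    refine setLIntegral_mono' hK fun x hx => ?_
    simp_rw [add_comm ((1 - s) • x)]
    exact setLIntegral_comp_smul_add_le μ hK hH h fun y hy => add_comm (s • y) _ ▸ hmem hx hy

/-- Averaging estimate: integrating a nonnegative function along segments joining pairs of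
points of a compact convex set `K` is controlled, with a factor `2^d · λ(K)`, by its
integral over `K`. -/
theorem average_along_segments_le
    (d : ℕ) (hd : 1 ≤ d)
    (K : Set (EuclideanSpace ℝ (Fin d)))
    (hKcomp : IsCompact K) (hKconv : Convex ℝ K)
    (H : EuclideanSpace ℝ (Fin d) → ℝ≥0∞) (hH : Measurable H) :
    ∫⁻ p in K ×ˢ K, (∫⁻ s in Set.Icc (0:ℝ) 1, H ((1 - s) • p.1 + s • p.2))
        ∂(volume.prod volume)
      ≤ 2 ^ d * volume K * ∫⁻ y in K, H y := by
  have hmeas : Measurable fun q : (EuclideanSpace ℝ (Fin d) × EuclideanSpace ℝ (Fin d)) × ℝ =>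
      H ((1 - q.2) • q.1.1 + q.2 • q.1.2) :=
    hH.comp (by fun_prop)
  rw [lintegral_lintegral_swap hmeas.aemeasurable]
  calc ∫⁻ s in Set.Icc (0 : ℝ) 1, ∫⁻ p in K ×ˢ K, H ((1 - s) • p.1 + s • p.2)
        ∂(volume.prod volume)
      ≤ ∫⁻ _ in Set.Icc (0 : ℝ) 1, 2 ^ d * volume K * ∫⁻ y in K, H y :=
        setLIntegral_mono' measurableSet_Icc fun s hs => by
          simpa only [finrank_euclideanSpace_fin] using
            hKconv.setLIntegral_prod_comp_segment_le volume hKcomp.measurableSet hH hs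
    _ = 2 ^ d * volume K * ∫⁻ y in K, H y := by simp
end

section
/- Let d ≥ 1, let K ⊂ ℝ^d be a compact convex set equipped with Lebesgue measure λ, and let B be a continuous map assigning to each point of K a self-adjoint positive semidefinite continuous linear endomorphism of ℝ^d. Then ∫_{K×K} L_B(x₁,x₂)² d(λ×λ)(x₁, x₂) ≤ (diam K)² · 2^d · λ(K) · ∫_K ‖B(y)‖ dλ(y), where diam K is the Euclidean diameter of K and ‖·‖ is the operator norm. -/
open MeasureTheory
open scoped RealInnerProductSpace

/-- Affine change of variables with ratio at least `1/2`, for nonnegative functions. -/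
theorem lintegral_comp_add_smul_le {E : Type*} [NormedAddCommGroup E] [NormedSpace ℝ E]
    [MeasurableSpace E] [BorelSpace E] [FiniteDimensional ℝ E] (μ : Measure E)
    [μ.IsAddHaarMeasure] {G : E → ENNReal} (hG : Measurable G) (a : E) {s : ℝ}
    (hs : 1 / 2 ≤ s) :
    ∫⁻ y, G (a + s • y) ∂μ ≤ 2 ^ Module.finrank ℝ E * ∫⁻ y, G y ∂μ := by
  have hs0 : 0 < s := by linarith
  have hscale : ∫⁻ y, G (a + s • y) ∂μ = ∫⁻ z, G (a + z) ∂(Measure.map (s • ·) μ) :=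
    (lintegral_map (f := fun z => G (a + z)) (by fun_prop) (by fun_prop)).symm
  rw [hscale, Measure.map_addHaar_smul μ hs0.ne', lintegral_smul_measure,
    lintegral_add_left_eq_self G a, smul_eq_mul]
  gcongr
  rw [abs_of_nonneg (by positivity), ← inv_pow]
  have hinv : s⁻¹ ≤ 2 := by
    rw [inv_le_comm₀ hs0 (by norm_num)]
    linarith
  calc ENNReal.ofReal (s⁻¹ ^ Module.finrank ℝ E)
      ≤ ENNReal.ofReal (2 ^ Module.finrank ℝ E) := by gcongr
    _ = 2 ^ Module.finrank ℝ E := by rw [ENNReal.ofReal_pow (by norm_num)]; simp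

/-- For a probability measure, the square of an integral is at most the integral of the square. -/
theorem lintegral_sq_le_lintegral_sq {α : Type*} [MeasurableSpace α] (μ : Measure α)
    [IsProbabilityMeasure μ] {h : α → ENNReal} (hh : AEMeasurable h μ) :
    (∫⁻ s, h s ∂μ) ^ 2 ≤ ∫⁻ s, h s ^ 2 ∂μ := by
  have H := ENNReal.lintegral_mul_le_Lp_mul_Lq μ Real.HolderConjugate.two_two hh
    (aemeasurable_const (b := (1 : ENNReal)))
  simp only [Pi.mul_apply, mul_one, lintegral_const, measure_univ,
    ENNReal.rpow_two, one_pow, ENNReal.one_rpow] at H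
  calc (∫⁻ s, h s ∂μ) ^ 2 ≤ ((∫⁻ s, h s ^ 2 ∂μ) ^ (1 / 2 : ℝ)) ^ 2 := by gcongr
    _ = ∫⁻ s, h s ^ 2 ∂μ := by
      rw [← ENNReal.rpow_two, ← ENNReal.rpow_mul]
      norm_num

/-- The integrals of a nonnegative function along the segments with endpoints in `K`, integrated
over all pairs of endpoints, are controlled by the integral of the function. -/
theorem lintegral_prod_lintegral_segment_le {E : Type*} [NormedAddCommGroup E] [NormedSpace ℝ E]
    [MeasurableSpace E] [BorelSpace E] [FiniteDimensional ℝ E] (μ : Measure E)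
    [μ.IsAddHaarMeasure] {G : E → ENNReal} (hG : Measurable G) (K : Set E) :
    ∫⁻ p in K ×ˢ K, (∫⁻ s in Set.Ioc (0 : ℝ) 1, G ((1 - s) • p.1 + s • p.2)) ∂(μ.prod μ)
      ≤ 2 ^ Module.finrank ℝ E * μ K * ∫⁻ y, G y ∂μ := by
  have hslice (s : ℝ) : ∫⁻ p in K ×ˢ K, G ((1 - s) • p.1 + s • p.2) ∂(μ.prod μ)
      ≤ 2 ^ Module.finrank ℝ E * μ K * ∫⁻ y, G y ∂μ := by
    have hconst : ∫⁻ _ in K, 2 ^ Module.finrank ℝ E * ∫⁻ y, G y ∂μ ∂μ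
        = 2 ^ Module.finrank ℝ E * μ K * ∫⁻ y, G y ∂μ := by
      rw [setLIntegral_const]
      ring
    rw [← Measure.prod_restrict, ← hconst]
    rcases le_total (1 / 2) s with hs | hs
    · rw [lintegral_prod _ (by fun_prop)]
      exact lintegral_mono fun x => (setLIntegral_le_lintegral _ _).trans
        (lintegral_comp_add_smul_le μ hG ((1 - s) • x) hs)
    · rw [lintegral_prod_symm _ (by fun_prop)]
      refine lintegral_mono fun y => (setLIntegral_le_lintegral _ _).trans ?_
      simp only [add_comm _ (s • y)]
      exact lintegral_comp_add_smul_le μ hG _ (by linarith)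
  rw [lintegral_lintegral_swap (by fun_prop)]
  calc _ ≤ ∫⁻ _ in Set.Ioc (0 : ℝ) 1, 2 ^ Module.finrank ℝ E * μ K * ∫⁻ y, G y ∂μ :=
        lintegral_mono hslice
    _ = _ := by simp

/-- The square of the length of a segment with respect to `B` is controlled by the integral of
`‖B‖` along the segment. -/
theorem enorm_segment_length_sq_le {E : Type*} [NormedAddCommGroup E] [InnerProductSpace ℝ E]
    {K : Set E} (hKbdd : Bornology.IsBounded K) (hKconv : Convex ℝ K) {B : E → E →L[ℝ] E}
    (hBcont : ContinuousOn B K) {x y : E} (hx : x ∈ K) (hy : y ∈ K) :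
    ‖(∫ s in (0 : ℝ)..1, √⟪B ((1 - s) • x + s • y) (y - x), y - x⟫) ^ 2‖ₑ
      ≤ ENNReal.ofReal (Metric.diam K ^ 2) *
        ∫⁻ s in Set.Ioc (0 : ℝ) 1, K.indicator (fun z => ‖B z‖ₑ) ((1 - s) • x + s • y) := by
  have : IsProbabilityMeasure (volume.restrict (Set.Ioc (0 : ℝ) 1)) := ⟨by simp⟩
  have hmem : ∀ s ∈ Set.Ioc (0 : ℝ) 1, (1 - s) • x + s • y ∈ K := fun s hs =>
    hKconv hx hy (by linarith [hs.2]) hs.1.le (by ring)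
  have hcont : ContinuousOn (fun s : ℝ => √⟪B ((1 - s) • x + s • y) (y - x), y - x⟫)
      (Set.Ioc 0 1) := by
    have hBγ : ContinuousOn (fun s : ℝ => B ((1 - s) • x + s • y)) (Set.Ioc 0 1) :=
      hBcont.comp (by fun_prop) hmem
    exact ((hBγ.clm_apply continuousOn_const).inner continuousOn_const).sqrt
  rw [intervalIntegral.integral_of_le zero_le_one, enorm_pow]
  calc _ ≤ (∫⁻ s in Set.Ioc (0 : ℝ) 1, ‖√⟪B ((1 - s) • x + s • y) (y - x), y - x⟫‖ₑ) ^ 2 := by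
        gcongr
        exact enorm_integral_le_lintegral_enorm _
    _ ≤ ∫⁻ s in Set.Ioc (0 : ℝ) 1, ‖√⟪B ((1 - s) • x + s • y) (y - x), y - x⟫‖ₑ ^ 2 :=
        lintegral_sq_le_lintegral_sq _ (hcont.aemeasurable measurableSet_Ioc).enorm
    _ ≤ ∫⁻ s in Set.Ioc (0 : ℝ) 1, ENNReal.ofReal (Metric.diam K ^ 2) *
          K.indicator (fun z => ‖B z‖ₑ) ((1 - s) • x + s • y) := by
        refine setLIntegral_mono' measurableSet_Ioc fun s hs => ?_
        rw [Set.indicator_of_mem (hmem s hs), ← ofReal_norm, ← ofReal_norm,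
          ← ENNReal.ofReal_pow (norm_nonneg _), ← ENNReal.ofReal_mul (by positivity)]
        refine ENNReal.ofReal_le_ofReal ?_
        have hdiam : ‖y - x‖ ≤ Metric.diam K := by
          rw [← dist_eq_norm]
          exact Metric.dist_le_diam_of_mem hKbdd hy hx
        have hsqrt {t C : ℝ} (hC : 0 ≤ C) (ht : t ≤ C) : ‖√t‖ ^ 2 ≤ C := by
          rw [Real.norm_eq_abs, sq_abs, Real.sq_sqrt']
          exact max_le ht hC
        refine hsqrt (by positivity) ?_
        calc _ ≤ ‖B ((1 - s) • x + s • y) (y - x)‖ * ‖y - x‖ := real_inner_le_norm _ _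
          _ ≤ ‖B ((1 - s) • x + s • y)‖ * ‖y - x‖ * ‖y - x‖ := by
            gcongr
            exact ContinuousLinearMap.le_opNorm _ _
          _ = ‖y - x‖ ^ 2 * ‖B ((1 - s) • x + s • y)‖ := by ring
          _ ≤ _ := by gcongr
    _ = _ := lintegral_const_mul' _ _ ENNReal.ofReal_ne_top

/-- Main integral estimate in the proof of the Demailly–Păun–Schneider lemma: the average
over pairs of endpoints in `K × K` of the squared `B`-length of the connecting segment is
bounded by `(diam K)² · 2^d · λ(K)` times the `L¹`-norm of the operator norm of `B` on `K`. -/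
theorem integral_segment_length_sq_le
    (d : ℕ) (hd : 1 ≤ d)
    (K : Set (EuclideanSpace ℝ (Fin d)))
    (hKcomp : IsCompact K) (hKconv : Convex ℝ K)
    (B : EuclideanSpace ℝ (Fin d) → (EuclideanSpace ℝ (Fin d) →L[ℝ] EuclideanSpace ℝ (Fin d)))
    (hBsa : ∀ x ∈ K, ∀ v w, ⟪B x v, w⟫ = ⟪v, B x w⟫)
    (hBpos : ∀ x ∈ K, ∀ v, 0 ≤ ⟪B x v, v⟫)
    (hBcont : ContinuousOn B K) :
    ∫ p in K ×ˢ K,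
        (∫ s in (0:ℝ)..1,
          Real.sqrt ⟪B ((1 - s) • p.1 + s • p.2) (p.2 - p.1), p.2 - p.1⟫) ^ 2
        ∂(volume.prod volume)
      ≤ (Metric.diam K) ^ 2 * 2 ^ d * (volume K).toReal * ∫ y in K, ‖B y‖ := by
  have hKmeas := hKcomp.measurableSet
  set G := K.indicator fun z => ‖B z‖ₑ with hGdef
  have hG : Measurable G := by
    classical
    rw [hGdef, ← Set.piecewise_eq_indicator]
    exact hBcont.enorm.measurable_piecewise continuousOn_const hKmeas
  have hint : IntegrableOn (fun y => ‖B y‖) K := hBcont.norm.integrableOn_compact hKcomp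
  have hGint : ∫⁻ y, G y = ENNReal.ofReal (∫ y in K, ‖B y‖) := by
    rw [hGdef, lintegral_indicator hKmeas,
      ofReal_integral_eq_lintegral_ofReal hint (ae_of_all _ fun _ => norm_nonneg _)]
    simp only [ofReal_norm]
  have hI : 0 ≤ ∫ y in K, ‖B y‖ := integral_nonneg fun _ => norm_nonneg _
  refine (ENNReal.ofReal_le_ofReal_iff (by positivity)).1 ?_
  refine (Real.ofReal_le_enorm _).trans ((enorm_integral_le_lintegral_enorm _).trans ?_)
  calc _ ≤ ∫⁻ p in K ×ˢ K, ENNReal.ofReal (Metric.diam K ^ 2) *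
          (∫⁻ s in Set.Ioc (0 : ℝ) 1, G ((1 - s) • p.1 + s • p.2)) ∂(volume.prod volume) :=
        setLIntegral_mono' (hKmeas.prod hKmeas) fun p hp =>
          enorm_segment_length_sq_le hKcomp.isBounded hKconv hBcont hp.1 hp.2
    _ ≤ ENNReal.ofReal (Metric.diam K ^ 2) *
          (2 ^ d * volume K * ENNReal.ofReal (∫ y in K, ‖B y‖)) := by
        rw [lintegral_const_mul' _ _ ENNReal.ofReal_ne_top, ← hGint]
        gcongr
        simpa using lintegral_prod_lintegral_segment_le volume hG K
    _ = _ := by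
        rw [ENNReal.ofReal_mul (by positivity), ENNReal.ofReal_mul (by positivity),
          ENNReal.ofReal_mul (by positivity), ENNReal.ofReal_toReal hKcomp.measure_ne_top,
          ENNReal.ofReal_pow (by norm_num : (0 : ℝ) ≤ 2), ENNReal.ofReal_ofNat]
        ring
end

section
/- Let n ≥ 1, let U ⊆ ℂ^n be a connected open set, and let g₁, …, g_r : U → ℂ be holomorphic functions, not all identically zero on U. Then for every compact set K ⊆ U there exists ε > 0 such that ∫_K (|g₁(z)|² + ⋯ + |g_r(z)|²)^{−ε} dλ(z) < ∞, where λ denotes Lebesgue measure on ℂ^n ≅ ℝ^{2n}. -/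
open MeasureTheory
open Filter Set Topology Metric
open scoped ENNReal

/-- **Sublevel set estimate.** If `Φ 0, …, Φ k` are successive derivatives on an interval `I` and
`Φ k ≥ c > 0` there, then the set where `|Φ 0| < δ` has measure at most
`4 ^ k (δ / c) ^ (2 ^ -k)`. -/
theorem volume_abs_lt_le_of_le_deriv (k : ℕ) :
    ∀ (Φ : ℕ → ℝ → ℝ) (I : Set ℝ), I.OrdConnected →
      (∀ j < k, ∀ t ∈ I, HasDerivAt (Φ j) (Φ (j + 1) t) t) →
      ∀ c : ℝ, 0 < c → (∀ t ∈ I, c ≤ Φ k t) → ∀ δ : ℝ, 0 < δ → δ ≤ c →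
        volume (I ∩ {t | |Φ 0 t| < δ}) ≤ ENNReal.ofReal (4 ^ k * (δ / c) ^ ((1 / 2 : ℝ) ^ k)) := by
  induction k with
  | zero =>
    intro Φ I _ _ c _ hΦc δ _ hδc
    have : I ∩ {t | |Φ 0 t| < δ} = ∅ := by
      ext t
      simp only [mem_inter_iff, mem_ofPred_eq, mem_empty_iff_false, iff_false, not_and, not_lt]
      intro ht
      exact (hδc.trans (hΦc t ht)).trans (le_abs_self _)
    simp [this]
  | succ k ih =>
    intro Φ I hI hΦ c hc hΦc δ hδ hδc
    set q : ℝ := √(δ / c) with hq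
    have hq0 : 0 < q := Real.sqrt_pos.2 (by positivity)
    have hqq : q * q = δ / c := Real.mul_self_sqrt (by positivity)
    have hδq : δ = c * q * q := by rw [mul_assoc, hqq]; field_simp
    have hq1 : q ≤ 1 := Real.sqrt_le_one.2 ((div_le_one hc).2 hδc)
    have hs : 0 < c * q := by positivity
    have hδs : δ ≤ c * q := by rw [hδq]; nlinarith
    have hratio : δ / (c * q) = q := by rw [hδq]; field_simp
    have hgrow : ∀ x ∈ I, ∀ y ∈ I, x ≤ y → c * (y - x) ≤ Φ k y - Φ k x := by
      refine hI.convex.mul_sub_le_image_sub_of_le_deriv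
        (fun t ht => (hΦ k (by omega) t ht).continuousAt.continuousWithinAt)
        (fun t ht =>
          (hΦ k (by omega) t (interior_subset ht)).differentiableAt.differentiableWithinAt) ?_
      intro t ht
      rw [(hΦ k (by omega) t (interior_subset ht)).deriv]
      exact hΦc t (interior_subset ht)
    have hmono : MonotoneOn (Φ k) I := fun x hx y hy hxy => by
      nlinarith [hgrow x hx y hy hxy, mul_nonneg hc.le (sub_nonneg.2 hxy)]
    have hupper : volume ((I ∩ {t | c * q ≤ Φ k t}) ∩ {t | |Φ 0 t| < δ}) ≤
        ENNReal.ofReal (4 ^ k * q ^ ((1 / 2 : ℝ) ^ k)) := by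
      have := ih Φ (I ∩ {t | c * q ≤ Φ k t}) ⟨?_⟩ (fun j hj t ht => hΦ j (by omega) t ht.1) _ hs
        (fun t ht => ht.2) δ hδ hδs
      · rwa [hratio] at this
      rintro x ⟨hx, hx'⟩ y ⟨hy, -⟩ z hz
      have hzI := hI.out hx hy hz
      exact ⟨hzI, le_trans hx' (hmono hx hzI hz.1)⟩
    have hlower : volume ((I ∩ {t | c * q ≤ -Φ k t}) ∩ {t | |Φ 0 t| < δ}) ≤
        ENNReal.ofReal (4 ^ k * q ^ ((1 / 2 : ℝ) ^ k)) := by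
      have := ih (fun j t => -Φ j t) (I ∩ {t | c * q ≤ -Φ k t}) ⟨?_⟩
        (fun j hj t ht => (hΦ j (by omega) t ht.1).neg) _ hs (fun t ht => ht.2) δ hδ hδs
      · simpa only [abs_neg, hratio] using this
      rintro x ⟨hx, -⟩ y ⟨hy, hy'⟩ z hz
      have hzI := hI.out hx hy hz
      exact ⟨hzI, le_trans hy' (neg_le_neg (hmono hzI hy hz.2))⟩
    have hmiddle : volume (I ∩ {t | |Φ k t| < c * q}) ≤ ENNReal.ofReal (2 * q) := by
      refine (Real.volume_le_diam _).trans (ediam_le fun x hx y hy => ?_)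
      rw [edist_dist]
      refine ENNReal.ofReal_le_ofReal ?_
      obtain ⟨hx, hx'⟩ := hx
      obtain ⟨hy, hy'⟩ := hy
      rw [mem_ofPred_eq, abs_lt] at hx' hy'
      rw [Real.dist_eq, abs_le]
      rcases le_total x y with hxy | hxy
      · have := hgrow x hx y hy hxy
        exact ⟨le_of_mul_le_mul_left (by linarith) hc, by linarith⟩
      · have := hgrow y hy x hx hxy
        exact ⟨by linarith, le_of_mul_le_mul_left (by linarith) hc⟩
    have hpow : (δ / c) ^ ((1 / 2 : ℝ) ^ (k + 1)) = q ^ ((1 / 2 : ℝ) ^ k) := by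
      rw [hq, Real.sqrt_eq_rpow, ← Real.rpow_mul (by positivity), pow_succ']
    have hqpow : q ≤ q ^ ((1 / 2 : ℝ) ^ k) :=
      Real.self_le_rpow_of_le_one hq0.le hq1 (pow_le_one₀ (by norm_num) (by norm_num))
    have hcover : I ∩ {t | |Φ 0 t| < δ} ⊆
        ((I ∩ {t | c * q ≤ Φ k t}) ∩ {t | |Φ 0 t| < δ} ∪
          (I ∩ {t | c * q ≤ -Φ k t}) ∩ {t | |Φ 0 t| < δ}) ∪ I ∩ {t | |Φ k t| < c * q} := by
      rintro t ⟨ht, htδ⟩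
      by_cases h : |Φ k t| < c * q
      · exact Or.inr ⟨ht, h⟩
      · rcases le_abs.1 (not_lt.1 h) with h | h
        · exact Or.inl (Or.inl ⟨⟨ht, h⟩, htδ⟩)
        · exact Or.inl (Or.inr ⟨⟨ht, h⟩, htδ⟩)
    calc volume (I ∩ {t | |Φ 0 t| < δ})
        ≤ ENNReal.ofReal (4 ^ k * q ^ ((1 / 2 : ℝ) ^ k)) +
            ENNReal.ofReal (4 ^ k * q ^ ((1 / 2 : ℝ) ^ k)) + ENNReal.ofReal (2 * q) :=
          (measure_mono hcover).trans <| (measure_union_le _ _).trans <|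
            add_le_add ((measure_union_le _ _).trans (add_le_add hupper hlower)) hmiddle
      _ = ENNReal.ofReal (4 ^ k * q ^ ((1 / 2 : ℝ) ^ k) + 4 ^ k * q ^ ((1 / 2 : ℝ) ^ k) + 2 * q) := by
          rw [← ENNReal.ofReal_add (by positivity) (by positivity),
            ← ENNReal.ofReal_add (by positivity) (by positivity)]
      _ ≤ ENNReal.ofReal (4 ^ (k + 1) * (δ / c) ^ ((1 / 2 : ℝ) ^ (k + 1))) := by
          refine ENNReal.ofReal_le_ofReal ?_
          rw [hpow, pow_succ]
          have h4 : (1 : ℝ) ≤ 4 ^ k := one_le_pow₀ (by norm_num)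
          have h0 : 0 < q ^ ((1 / 2 : ℝ) ^ k) := by positivity
          nlinarith [mul_le_mul_of_nonneg_right h4 h0.le]

section Lines

variable {E : Type*} [NormedAddCommGroup E] [NormedSpace ℂ E] {g : E → ℂ} {U : Set E}

theorem DifferentiableOn.comp_line (hg : DifferentiableOn ℂ g U) (z v : E) :
    DifferentiableOn ℂ (fun ζ : ℂ => g (z + ζ • v)) {ζ : ℂ | z + ζ • v ∈ U} :=
  hg.comp (f := fun ζ : ℂ => z + ζ • v) (by fun_prop) fun _ h => h

theorem IsOpen.preimage_line (hU : IsOpen U) (z v : E) : IsOpen {ζ : ℂ | z + ζ • v ∈ U} :=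
  hU.preimage (f := fun ζ : ℂ => z + ζ • v) (by fun_prop)

theorem isPreconnected_preimage_line_ball (a z v : E) (ρ : ℝ) :
    IsPreconnected {ζ : ℂ | z + ζ • v ∈ ball a ρ} := by
  have h := ((convex_ball a ρ).translate_preimage_right z).is_linear_preimage
    (f := fun ζ : ℂ => ζ • v) ((LinearMap.toSpanSingleton ℂ E v).restrictScalars ℝ).isLinear
  exact h.isPreconnected

/-- Identity theorem on a ball, obtained by restriction to complex lines. -/
theorem DifferentiableOn.eqOn_zero_ball_of_eventuallyEq_zero {a w : E} {ρ : ℝ}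
    (hg : DifferentiableOn ℂ g (ball a ρ)) (hw : w ∈ ball a ρ) (h : g =ᶠ[𝓝 w] 0) :
    EqOn g 0 (ball a ρ) := by
  intro z hz
  have hf := (hg.comp_line w (z - w)).analyticOnNhd (isOpen_ball.preimage_line w (z - w))
  have h0 : (fun ζ : ℂ => g (w + ζ • (z - w))) =ᶠ[𝓝 0] 0 := by
    have hc : Tendsto (fun ζ : ℂ => w + ζ • (z - w)) (𝓝 0) (𝓝 w) := by
      have : Continuous fun ζ : ℂ => w + ζ • (z - w) := by fun_prop
      simpa using this.tendsto 0
    exact hc.eventually h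
  have := hf.eqOn_zero_of_preconnected_of_eventuallyEq_zero
    (isPreconnected_preimage_line_ball a w (z - w) ρ) (by simpa using hw) h0
    (show (1 : ℂ) ∈ _ by simpa using hz)
  simpa using this

theorem DifferentiableOn.not_eventuallyEq_zero_of_isPreconnected (hg : DifferentiableOn ℂ g U)
    (hU : IsOpen U) (hUc : IsPreconnected U) {w : E} (hw : w ∈ U) (hgw : g w ≠ 0) {a : E}
    (ha : a ∈ U) : ¬ g =ᶠ[𝓝 a] 0 := by
  intro h
  refine hgw (EventuallyEq.eq_of_nhds
    (hUc.induction₂' (fun x y => g =ᶠ[𝓝 x] 0 → g =ᶠ[𝓝 y] 0) ?_ ?_ ha hw h))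
  · intro x hx
    obtain ⟨ρ, hρ, hball⟩ := Metric.isOpen_iff.1 hU x hx
    have key : ∀ y ∈ ball x ρ, ∀ z ∈ ball x ρ, g =ᶠ[𝓝 y] 0 → g =ᶠ[𝓝 z] 0 := fun y hy z hz h =>
      ((hg.mono hball).eqOn_zero_ball_of_eventuallyEq_zero hy h).eventuallyEq_of_mem
        (isOpen_ball.mem_nhds hz)
    filter_upwards [mem_nhdsWithin_of_mem_nhds (ball_mem_nhds x hρ)] with y hy
    exact ⟨key x (mem_ball_self hρ) y hy, key y hy x (mem_ball_self hρ)⟩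
  · intro x y z _ _ _ hxy hyz hx
    exact hyz (hxy hx)

/-- Iterated derivatives along a fixed complex direction depend continuously on the base point. -/
theorem DifferentiableOn.continuousAt_iteratedDeriv_line (hg : DifferentiableOn ℂ g U)
    (hU : IsOpen U) {a : E} (ha : a ∈ U) (v : E) (k : ℕ) :
    ContinuousAt (fun z => iteratedDeriv k (fun ζ : ℂ => g (z + ζ • v)) 0) a := by
  obtain ⟨R, hR, hRU⟩ := nhds_basis_closedBall.mem_iff.1
    ((hU.preimage_line a v).mem_nhds (show (0 : ℂ) ∈ _ by simpa using ha))
  rw [Metric.continuousAt_iff']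
  intro e he
  set e' : ℝ := e * R ^ k / (2 * k.factorial) with he'
  have he'0 : 0 < e' := by positivity
  have hloc : ∀ ζ ∈ closedBall (0 : ℂ) R, ∀ᶠ p : E × ℂ in 𝓝 (a, ζ),
      p.1 + p.2 • v ∈ U ∧ ‖g (p.1 + p.2 • v) - g (a + p.2 • v)‖ ≤ e' := by
    intro ζ hζ
    have hgc : ContinuousAt g (a + ζ • v) :=
      (hg.differentiableAt (hU.mem_nhds (hRU hζ))).continuousAt
    have h1 : Tendsto (fun p : E × ℂ => p.1 + p.2 • v) (𝓝 (a, ζ)) (𝓝 (a + ζ • v)) :=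
      Continuous.tendsto (f := fun p : E × ℂ => p.1 + p.2 • v) (by fun_prop) (a, ζ)
    have h2 : Tendsto (fun p : E × ℂ => a + p.2 • v) (𝓝 (a, ζ)) (𝓝 (a + ζ • v)) :=
      Continuous.tendsto (f := fun p : E × ℂ => a + p.2 • v) (by fun_prop) (a, ζ)
    have h3 := ((hgc.tendsto.comp h1).sub (hgc.tendsto.comp h2)).norm
    rw [sub_self, norm_zero] at h3
    filter_upwards [h1.eventually (hU.mem_nhds (hRU hζ)), h3.eventually (ge_mem_nhds he'0)]
      with p hp hp'
    exact ⟨hp, hp'⟩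
  have hev : ∀ᶠ z in 𝓝 a, ∀ ζ ∈ closedBall (0 : ℂ) R,
      z + ζ • v ∈ U ∧ ‖g (z + ζ • v) - g (a + ζ • v)‖ ≤ e' :=
    (isCompact_closedBall (0 : ℂ) R).eventually_forall_of_forall_eventually hloc
  filter_upwards [hev] with z hz
  have hdz : ∀ y : E, (∀ ζ ∈ closedBall (0 : ℂ) R, y + ζ • v ∈ U) →
      AnalyticAt ℂ (fun ζ : ℂ => g (y + ζ • v)) 0 := fun y hy =>
    (hg.comp_line y v).analyticAt ((hU.preimage_line y v).mem_nhds
      (hy 0 (mem_closedBall_self hR.le)))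
  have hsub : iteratedDeriv k (fun ζ : ℂ => g (z + ζ • v) - g (a + ζ • v)) 0 =
      iteratedDeriv k (fun ζ : ℂ => g (z + ζ • v)) 0 -
        iteratedDeriv k (fun ζ : ℂ => g (a + ζ • v)) 0 :=
    iteratedDeriv_fun_sub (hdz z fun ζ hζ => (hz ζ hζ).1).contDiffAt
      (hdz a fun ζ hζ => hRU hζ).contDiffAt
  have hdiff : DiffContOnCl ℂ (fun ζ : ℂ => g (z + ζ • v) - g (a + ζ • v)) (ball 0 R) := by
    refine DifferentiableOn.diffContOnCl_ball (U := closedBall 0 R) ?_ subset_rfl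
    exact ((hg.comp_line z v).mono fun ζ hζ => (hz ζ hζ).1).sub ((hg.comp_line a v).mono hRU)
  rw [dist_eq_norm, ← hsub]
  refine (Complex.norm_iteratedDeriv_le_of_forall_mem_sphere_norm_le k hR hdiff
    fun ζ hζ => (hz ζ (sphere_subset_closedBall hζ)).2).trans_lt ?_
  have : k.factorial * e' / R ^ k = e / 2 := by rw [he']; field_simp
  rw [this]
  linarith

theorem DifferentiableOn.exists_iteratedDeriv_line_ne_zero (hg : DifferentiableOn ℂ g U)
    (hU : IsOpen U) {a : E} (ha : a ∈ U) (h : ¬ g =ᶠ[𝓝 a] 0) :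
    ∃ (v : E) (k : ℕ), iteratedDeriv k (fun ζ : ℂ => g (a + ζ • v)) 0 ≠ 0 := by
  obtain ⟨ρ, hρ, hball⟩ := Metric.isOpen_iff.1 hU a ha
  obtain ⟨w, hw, hgw⟩ : ∃ w ∈ ball a ρ, g w ≠ 0 := by
    by_contra! hcon
    exact h (eventually_of_mem (ball_mem_nhds a hρ) hcon)
  refine ⟨w - a, ?_⟩
  by_contra! hcon
  have hf := ((hg.mono hball).comp_line a (w - a)).analyticOnNhd (isOpen_ball.preimage_line a (w - a))
  have h0 : (0 : ℂ) ∈ {ζ : ℂ | a + ζ • (w - a) ∈ ball a ρ} := by simpa using hρ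
  have htop : analyticOrderAt (fun ζ : ℂ => g (a + ζ • (w - a))) 0 = ⊤ :=
    ENat.eq_top_iff_forall_ge.2 fun m =>
      (natCast_le_analyticOrderAt_iff_iteratedDeriv_eq_zero (hf 0 h0)).2 fun i _ => hcon i
  have := hf.eqOn_zero_of_preconnected_of_eventuallyEq_zero
    (isPreconnected_preimage_line_ball a a (w - a) ρ) h0 (analyticOrderAt_eq_top.1 htop)
    (show (1 : ℂ) ∈ _ by simpa [dist_eq_norm] using hw)
  exact hgw (by simpa using this)

end Lines

/-- If every segment `u + T • v` meets `S` in a set of parameters of measure at most `M`, and meets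
it at all only for `u ∈ B`, then `S` has measure at most `M * μ B / volume T`. -/
theorem MeasureTheory.volume_mul_measure_le_of_forall_line
    {E : Type*} [NormedAddCommGroup E] [NormedSpace ℝ E]
    [MeasurableSpace E] [BorelSpace E] [SecondCountableTopology E] (μ : Measure E) [SFinite μ] [μ.IsAddRightInvariant] {S B : Set E} (hS : MeasurableSet S)
    (hB : MeasurableSet B) {T : Set ℝ} (v : E) {M : ℝ≥0∞}
    (hM : ∀ u, volume (T ∩ {t | u + t • v ∈ S}) ≤ M)
    (hTB : ∀ u, ∀ t ∈ T, u + t • v ∈ S → u ∈ B) :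
    volume T * μ S ≤ M * μ B := by
  have hmeas : Measurable fun p : ℝ × E => S.indicator (1 : E → ℝ≥0∞) (p.2 + p.1 • v) :=
    (measurable_one.indicator hS).comp
      (Continuous.measurable (f := fun p : ℝ × E => p.2 + p.1 • v) (by fun_prop))
  calc volume T * μ S = ∫⁻ t in T, (∫⁻ u, S.indicator (1 : E → ℝ≥0∞) (u + t • v) ∂μ) := by
        have : ∀ t : ℝ, ∫⁻ u, S.indicator (1 : E → ℝ≥0∞) (u + t • v) ∂μ = μ S := fun t => by
          rw [lintegral_add_right_eq_self (S.indicator (1 : E → ℝ≥0∞)), lintegral_indicator_one hS]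
        simp only [this, lintegral_const, Measure.restrict_apply_univ, mul_comm]
    _ = ∫⁻ u, (∫⁻ t in T, S.indicator (1 : E → ℝ≥0∞) (u + t • v)) ∂μ :=
        lintegral_lintegral_swap (μ := volume.restrict T) (ν := μ)
          (f := fun t u => S.indicator (1 : E → ℝ≥0∞) (u + t • v)) hmeas.aemeasurable
    _ ≤ ∫⁻ u, B.indicator (fun _ => M) u ∂μ := by
        refine lintegral_mono fun u => ?_
        have hu : MeasurableSet {t : ℝ | u + t • v ∈ S} :=
          hS.preimage (Continuous.measurable (f := fun t : ℝ => u + t • v) (by fun_prop))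
        have : ∫⁻ t in T, S.indicator (1 : E → ℝ≥0∞) (u + t • v) =
            volume (T ∩ {t | u + t • v ∈ S}) := by
          rw [inter_comm, ← Measure.restrict_apply hu, ← lintegral_indicator_one hu]
          rfl
        simp only [this]
        by_cases huB : u ∈ B
        · simpa [huB] using hM u
        · have : T ∩ {t | u + t • v ∈ S} = ∅ :=
            eq_empty_of_forall_notMem fun t ht => huB (hTB u t ht.1 ht.2)
          simp [this]
    _ = M * μ B := by rw [lintegral_indicator_const hB]

/-- Dyadic majorant of a negative power. -/
theorem ENNReal.rpow_neg_le_add_tsum (x : ℝ≥0∞) {s : ℝ} (hs : 0 ≤ s) (N : ℕ) :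
    x ^ (-s) ≤ 2 ^ (s * N) + ∑' i : ℕ, {y : ℝ≥0∞ | y < 2⁻¹ ^ (N + i)}.indicator
      (fun _ => (2 : ℝ≥0∞) ^ (s * (N + i + 1 : ℕ))) x := by
  have hpow : ∀ m : ℕ, 2⁻¹ ^ m ≤ x → x ^ (-s) ≤ 2 ^ (s * m) := by
    intro m hm
    have := ENNReal.rpow_le_rpow hm hs
    rw [ENNReal.rpow_neg, ENNReal.inv_le_iff_inv_le, mul_comm, ENNReal.rpow_mul,
      ENNReal.rpow_natCast, ← ENNReal.inv_rpow, ENNReal.inv_pow]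
    exact this
  rcases eq_or_ne x 0 with rfl | hx
  · have htop : ∑' i : ℕ, {y : ℝ≥0∞ | y < 2⁻¹ ^ (N + i)}.indicator
        (fun _ => (2 : ℝ≥0∞) ^ (s * (N + i + 1 : ℕ))) 0 = ⊤ := by
      rw [eq_top_iff, ← ENNReal.tsum_const_eq_top_of_ne_zero (α := ℕ) one_ne_zero]
      refine ENNReal.tsum_le_tsum fun i => ?_
      rw [indicator_of_mem (by simp [ENNReal.pow_pos])]
      exact ENNReal.rpow_zero (x := 2) ▸
        ENNReal.rpow_le_rpow_of_exponent_le (by norm_num) (by positivity)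
    rw [htop]
    simp
  · by_cases hN : 2⁻¹ ^ N ≤ x
    · exact (hpow N hN).trans le_self_add
    · have hex : ∃ i : ℕ, 2⁻¹ ^ (N + i) ≤ x := by
        have := ENNReal.tendsto_pow_atTop_nhds_zero_of_lt_one
          (show (2⁻¹ : ℝ≥0∞) < 1 by simp)
        obtain ⟨m, hm⟩ := (this.eventually (Iic_mem_nhds (pos_iff_ne_zero.2 hx))).exists_forall_of_atTop
        exact ⟨m, hm (N + m) (by omega)⟩
      obtain ⟨i, hi, hi'⟩ : ∃ i : ℕ, x < 2⁻¹ ^ (N + i) ∧ 2⁻¹ ^ (N + i + 1) ≤ x := by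
        classical
        obtain ⟨i, hi⟩ : ∃ i, Nat.find hex = i + 1 :=
          Nat.exists_eq_succ_of_ne_zero fun h0 => hN (by simpa [h0] using Nat.find_spec hex)
        exact ⟨i, not_le.1 (Nat.find_min hex (by omega)), by
          simpa [hi, add_assoc] using Nat.find_spec hex⟩
      refine (hpow _ hi').trans (le_trans ?_ le_add_self)
      refine le_trans (le_of_eq ?_) (ENNReal.le_tsum i)
      rw [indicator_of_mem (by exact hi)]

section Sublevel

variable {E : Type*} [MeasurableSpace E]

/-- The measure of `S ∩ {‖g‖ < 2 ^ -j}` decays geometrically in `j`. -/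
def GeometricSublevelDecay (μ : Measure E) (g : E → ℂ) (S : Set E) : Prop :=
  ∃ α : ℝ, 0 < α ∧ ∃ C : ℝ≥0∞, C ≠ ⊤ ∧
    ∀ᶠ j : ℕ in atTop, μ (S ∩ {z | ‖g z‖ₑ < 2⁻¹ ^ j}) ≤ C * (2⁻¹ : ℝ≥0∞) ^ (α * j)

variable {μ : Measure E} {g : E → ℂ}

theorem GeometricSublevelDecay.mono {S T : Set E} (hST : S ⊆ T)
    (h : GeometricSublevelDecay μ g T) : GeometricSublevelDecay μ g S := by
  obtain ⟨α, hα, C, hC, h⟩ := h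
  refine ⟨α, hα, C, hC, h.mono fun j hj => (measure_mono ?_).trans hj⟩
  exact inter_subset_inter_left _ hST

theorem GeometricSublevelDecay.union {S T : Set E} (hS : GeometricSublevelDecay μ g S)
    (hT : GeometricSublevelDecay μ g T) : GeometricSublevelDecay μ g (S ∪ T) := by
  obtain ⟨α, hα, C, hC, hS⟩ := hS
  obtain ⟨β, hβ, D, hD, hT⟩ := hT
  refine ⟨min α β, lt_min hα hβ, C + D, ENNReal.add_ne_top.2 ⟨hC, hD⟩, ?_⟩
  filter_upwards [hS, hT] with j hj hj'
  rw [union_inter_distrib_right, add_mul]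
  have hle : ∀ γ, min α β ≤ γ →
      (2⁻¹ : ℝ≥0∞) ^ (γ * j) ≤ (2⁻¹ : ℝ≥0∞) ^ (min α β * j) := fun γ hγ =>
    ENNReal.rpow_le_rpow_of_exponent_ge (by simp)
      (mul_le_mul_of_nonneg_right hγ (Nat.cast_nonneg j))
  refine (measure_union_le _ _).trans (add_le_add (hj.trans ?_) (hj'.trans ?_))
  · exact mul_le_mul_right (hle α (min_le_left _ _)) C
  · exact mul_le_mul_right (hle β (min_le_right _ _)) D

variable [NormedAddCommGroup E] [BorelSpace E]

theorem GeometricSublevelDecay.exists_lintegral_rpow_neg_lt_top {S : Set E}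
    (h : GeometricSublevelDecay μ g S) (hS : MeasurableSet S) (hSμ : μ S ≠ ⊤)
    (hg : ContinuousOn g S) :
    ∃ s : ℝ, 0 < s ∧ ∫⁻ z in S, ‖g z‖ₑ ^ (-s) ∂μ < ⊤ := by
  obtain ⟨α, hα, C, hC, h⟩ := h
  obtain ⟨N, hN⟩ := eventually_atTop.1 h
  set s : ℝ := α / 2 with hs
  have hs0 : 0 < s := by positivity
  refine ⟨s, hs0, ?_⟩
  have hgm : AEMeasurable (fun z => ‖g z‖ₑ) (μ.restrict S) := (hg.aemeasurable hS).enorm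
  have hset : ∀ m : ℕ, MeasurableSet {y : ℝ≥0∞ | y < 2⁻¹ ^ m} := fun m => measurableSet_Iio
  have hterm : ∀ i : ℕ, ∫⁻ z in S, {y : ℝ≥0∞ | y < 2⁻¹ ^ (N + i)}.indicator
      (fun _ => (2 : ℝ≥0∞) ^ (s * (N + i + 1 : ℕ))) ‖g z‖ₑ ∂μ ≤
        2 ^ s * C * ((2⁻¹ : ℝ≥0∞) ^ s) ^ i := by
    intro i
    have hnull : NullMeasurableSet {z | ‖g z‖ₑ < 2⁻¹ ^ (N + i)} (μ.restrict S) :=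
      hgm.nullMeasurableSet_preimage (hset _)
    have : ∫⁻ z in S, {y : ℝ≥0∞ | y < 2⁻¹ ^ (N + i)}.indicator
        (fun _ => (2 : ℝ≥0∞) ^ (s * (N + i + 1 : ℕ))) ‖g z‖ₑ ∂μ =
          2 ^ (s * (N + i + 1 : ℕ)) * μ (S ∩ {z | ‖g z‖ₑ < 2⁻¹ ^ (N + i)}) := by
      rw [inter_comm, ← Measure.restrict_apply₀ hnull, ← lintegral_indicator_const₀ hnull]
      rfl
    rw [this]
    calc (2 : ℝ≥0∞) ^ (s * (N + i + 1 : ℕ)) * μ (S ∩ {z | ‖g z‖ₑ < 2⁻¹ ^ (N + i)})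
        ≤ 2 ^ (s * (N + i + 1 : ℕ)) * (C * (2⁻¹ : ℝ≥0∞) ^ (α * (N + i : ℕ))) := by
          gcongr
          exact hN _ (by omega)
      _ = 2 ^ s * C * 2 ^ (-(s * (N + i))) := by
          have h1 : (2⁻¹ : ℝ≥0∞) ^ (α * (N + i : ℕ)) = 2 ^ (-(α * (N + i : ℕ))) := by
            rw [ENNReal.inv_rpow, ENNReal.rpow_neg]
          rw [h1, mul_left_comm, ← ENNReal.rpow_add _ _ (by simp) (by simp), mul_comm (2 ^ s) C,
            mul_assoc, ← ENNReal.rpow_add _ _ (by simp) (by simp)]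
          congr 2
          push_cast
          rw [hs]
          ring
      _ ≤ 2 ^ s * C * ((2⁻¹ : ℝ≥0∞) ^ s) ^ i := by
          gcongr
          rw [ENNReal.inv_rpow, ← ENNReal.rpow_neg, ← ENNReal.rpow_natCast, ← ENNReal.rpow_mul]
          refine ENNReal.rpow_le_rpow_of_exponent_le (by norm_num) ?_
          have : 0 ≤ s * N := by positivity
          linarith
  calc ∫⁻ z in S, ‖g z‖ₑ ^ (-s) ∂μ
      ≤ ∫⁻ z in S, (2 ^ (s * N) + ∑' i : ℕ, {y : ℝ≥0∞ | y < 2⁻¹ ^ (N + i)}.indicator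
          (fun _ => (2 : ℝ≥0∞) ^ (s * (N + i + 1 : ℕ))) ‖g z‖ₑ) ∂μ :=
        lintegral_mono fun z => ENNReal.rpow_neg_le_add_tsum _ hs0.le N
    _ = 2 ^ (s * N) * μ S + ∑' i : ℕ, ∫⁻ z in S, {y : ℝ≥0∞ | y < 2⁻¹ ^ (N + i)}.indicator
          (fun _ => (2 : ℝ≥0∞) ^ (s * (N + i + 1 : ℕ))) ‖g z‖ₑ ∂μ := by
        rw [lintegral_add_left measurable_const, lintegral_const, Measure.restrict_apply_univ,
          lintegral_tsum]
        exact fun i => (measurable_const.indicator (hset (N + i))).comp_aemeasurable hgm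
    _ ≤ 2 ^ (s * N) * μ S + ∑' i : ℕ, 2 ^ s * C * ((2⁻¹ : ℝ≥0∞) ^ s) ^ i := by
        gcongr with i
        exact hterm i
    _ < ⊤ := by
        rw [ENNReal.tsum_mul_left, ENNReal.tsum_geometric]
        have h2 : (2⁻¹ : ℝ≥0∞) ^ s < 1 := ENNReal.rpow_lt_one (by simp) hs0
        refine ENNReal.add_lt_top.2 ⟨ENNReal.mul_lt_top ?_ hSμ.lt_top, ENNReal.mul_lt_top
          (ENNReal.mul_lt_top ?_ hC.lt_top) (ENNReal.inv_lt_top.2 (tsub_pos_of_lt h2))⟩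
        · exact ENNReal.rpow_lt_top_of_nonneg (by positivity) (by simp)
        · exact ENNReal.rpow_lt_top_of_nonneg (by positivity) (by simp)

theorem DifferentiableOn.exists_nhds_geometricSublevelDecay [NormedSpace ℂ E] [ProperSpace E]
    [SFinite μ] [μ.IsAddRightInvariant] [IsFiniteMeasureOnCompacts μ]
    {U : Set E} (hg : DifferentiableOn ℂ g U) (hU : IsOpen U) {a : E} (ha : a ∈ U)
    (hne : ¬ g =ᶠ[𝓝 a] 0) : ∃ V ∈ 𝓝 a, GeometricSublevelDecay μ g V := by
  obtain ⟨v, k, hk⟩ := hg.exists_iteratedDeriv_line_ne_zero hU ha hne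
  set p : E → ℂ := fun z => iteratedDeriv k (fun ζ : ℂ => g (z + ζ • v)) 0 with hp
  set β : ℂ := (starRingEnd ℂ) (p a) / ‖p a‖ with hβ
  have hpa : 0 < ‖p a‖ := norm_pos_iff.2 hk
  have hβ1 : ‖β‖ = 1 := by
    rw [hβ, norm_div, RCLike.norm_conj, Complex.norm_real, norm_norm, div_self hpa.ne']
  have hβp : (β * p a).re = ‖p a‖ := by
    have : β * p a = (‖p a‖ : ℂ) := by
      rw [hβ, div_mul_eq_mul_div, Complex.conj_mul', sq, mul_div_assoc, div_self, mul_one]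
      exact_mod_cast hpa.ne'
    rw [this, Complex.ofReal_re]
  set c : ℝ := ‖p a‖ / 2 with hc
  have hc0 : 0 < c := by positivity
  have hlow : ∀ᶠ z in 𝓝 a, z ∈ U ∧ c ≤ (β * p z).re := by
    have hcont : ContinuousAt (fun z => (β * p z).re) a :=
      Complex.continuous_re.continuousAt.comp
        (continuousAt_const.mul (hg.continuousAt_iteratedDeriv_line hU ha v k))
    exact (hU.eventually_mem ha).and <| hcont.eventually (Ici_mem_nhds (by simp only [hβp]; linarith))
  obtain ⟨r, hr, hball⟩ := Metric.eventually_nhds_iff_ball.1 hlow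
  obtain ⟨τ, hτ, hτv⟩ : ∃ τ : ℝ, 0 < τ ∧ τ * ‖v‖ < r / 2 := by
    refine ⟨r / 2 / (‖v‖ + 1), by positivity, ?_⟩
    rw [div_mul_eq_mul_div, div_lt_iff₀ (by positivity)]
    nlinarith [norm_nonneg v]
  have hline : ∀ u : E, ∀ t₀ ∈ Icc (0 : ℝ) τ, u + t₀ • v ∈ ball a (r / 2) → ∀ t ∈ Icc (0 : ℝ) τ,
      u + t • v ∈ ball a r := by
    intro u t₀ ht₀ hu t ht
    have h1 : u + t • v - a = (u + t₀ • v - a) + (t - t₀) • v := by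
      rw [sub_smul]; abel
    have h2 : ‖(t - t₀) • v‖ < r / 2 := by
      rw [norm_smul, Real.norm_eq_abs]
      refine lt_of_le_of_lt (mul_le_mul_of_nonneg_right ?_ (norm_nonneg v)) hτv
      rw [abs_le]
      exact ⟨by linarith [ht.1, ht₀.2], by linarith [ht.2, ht₀.1]⟩
    rw [mem_ball_iff_norm] at hu ⊢
    rw [h1]
    linarith [norm_add_le (u + t₀ • v - a) ((t - t₀) • v)]
  have hmeas : ∀ δ : ℝ, 0 < δ → δ ≤ c → μ (ball a (r / 2) ∩ {z | ‖g z‖ < δ}) ≤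
      ENNReal.ofReal (4 ^ k * (δ / c) ^ ((1 / 2 : ℝ) ^ k)) * μ (ball a r) / ENNReal.ofReal τ := by
    intro δ hδ hδc
    have hsub : ball a (r / 2) ⊆ U := fun z hz =>
      (hball z (ball_subset_ball (by linarith) hz)).1
    have hopen : IsOpen (ball a (r / 2) ∩ {z | ‖g z‖ < δ}) :=
      (hg.continuousOn.mono hsub).norm.isOpen_inter_preimage isOpen_ball isOpen_Iio
    have hvol : volume (Icc (0 : ℝ) τ) = ENNReal.ofReal τ := by simp
    rw [ENNReal.le_div_iff_mul_le (by simp [hτ]) (by simp), mul_comm, ← hvol]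
    refine volume_mul_measure_le_of_forall_line μ hopen.measurableSet measurableSet_ball
      v (fun u => ?_) fun u t ht hu => by
        simpa using hline u t ht hu.1 0 (left_mem_Icc.2 hτ.le)
    by_cases hu : ∃ t₀ ∈ Icc (0 : ℝ) τ, u + t₀ • v ∈ ball a (r / 2)
    · obtain ⟨t₀, ht₀, hut₀⟩ := hu
      have hin := hline u t₀ ht₀ hut₀
      set F : ℂ → ℂ := fun ζ => g (u + ζ • v) with hF
      have hFan : ∀ t ∈ Icc (0 : ℝ) τ, AnalyticAt ℂ F t := fun t ht =>
        (hg.comp_line u v).analyticAt ((hU.preimage_line u v).mem_nhds (by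
          simpa using (hball _ (hin t ht)).1))
      have hFp : ∀ t : ℝ, iteratedDeriv k F t = p (u + t • v) := by
        intro t
        have := congrFun (iteratedDeriv_comp_const_add k F (t : ℂ)) 0
        simp only [add_zero] at this
        rw [← this, hp]
        simp only [hF, add_smul, add_assoc, Complex.coe_smul]
      refine le_trans (measure_mono ?_) (volume_abs_lt_le_of_le_deriv k
        (fun j t => (β * iteratedDeriv j F t).re) (Icc 0 τ) ordConnected_Icc ?_ c hc0 ?_ δ hδ hδc)
      · rintro t ⟨ht, htS⟩
        refine ⟨ht, lt_of_le_of_lt (Complex.abs_re_le_norm _) ?_⟩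
        rw [norm_mul, hβ1, one_mul, iteratedDeriv_zero]
        simpa [hF] using htS.2
      · intro j _ t ht
        refine HasDerivAt.real_of_complex (HasDerivAt.const_mul β ?_)
        rw [iteratedDeriv_succ, iteratedDeriv_eq_iterate]
        exact ((hFan t ht).iterated_deriv j).differentiableAt.hasDerivAt
      · intro t ht
        simp only [hFp]
        exact (hball _ (hin t ht)).2
    · have : Icc (0 : ℝ) τ ∩ {t | u + t • v ∈ ball a (r / 2) ∩ {z | ‖g z‖ < δ}} = ∅ :=
        eq_empty_of_forall_notMem fun t ht => hu ⟨t, ht.1, ht.2.1⟩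
      rw [this]
      simp
  refine ⟨ball a (r / 2), ball_mem_nhds a (by positivity), (1 / 2 : ℝ) ^ k, by positivity,
    ENNReal.ofReal (4 ^ k / c ^ ((1 / 2 : ℝ) ^ k)) * μ (ball a r) / ENNReal.ofReal τ,
    ENNReal.div_ne_top (ENNReal.mul_ne_top (by simp) measure_ball_lt_top.ne) (by simp [hτ]), ?_⟩
  have hsmall : ∀ᶠ j : ℕ in atTop, (1 / 2 : ℝ) ^ j ≤ c :=
    (tendsto_pow_atTop_nhds_zero_of_lt_one (by norm_num) (by norm_num)).eventually
      (Iic_mem_nhds hc0)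
  filter_upwards [hsmall] with j hj
  have hset : {z | ‖g z‖ₑ < 2⁻¹ ^ j} = {z | ‖g z‖ < (1 / 2 : ℝ) ^ j} := by
    ext z
    have : (2⁻¹ : ℝ≥0∞) ^ j = ENNReal.ofReal ((1 / 2 : ℝ) ^ j) := by
      rw [ENNReal.ofReal_pow (by norm_num), one_div, ENNReal.ofReal_inv_of_pos (by norm_num)]
      simp
    rw [mem_ofPred_eq, mem_ofPred_eq, this, ← ofReal_norm,
      ENNReal.ofReal_lt_ofReal_iff (by positivity)]
  rw [hset]
  refine (hmeas _ (by positivity) hj).trans (le_of_eq ?_)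
  have hpow : ENNReal.ofReal (4 ^ k * ((1 / 2 : ℝ) ^ j / c) ^ ((1 / 2 : ℝ) ^ k)) =
      ENNReal.ofReal (4 ^ k / c ^ ((1 / 2 : ℝ) ^ k)) * (2⁻¹ : ℝ≥0∞) ^ ((1 / 2 : ℝ) ^ k * j) := by
    have h2 : (2⁻¹ : ℝ≥0∞) = ENNReal.ofReal (1 / 2) := by
      rw [one_div, ENNReal.ofReal_inv_of_pos (by norm_num)]
      simp
    rw [h2, ENNReal.ofReal_rpow_of_pos (by norm_num), ← ENNReal.ofReal_mul (by positivity),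
      Real.div_rpow (by positivity) hc0.le, mul_comm ((1 / 2 : ℝ) ^ k) (j : ℝ),
      Real.rpow_mul (by norm_num), Real.rpow_natCast]
    ring_nf
  rw [hpow]
  simp only [div_eq_mul_inv]
  ring

end Sublevel

/-- Local integrability of a small negative power of `∑ |gᵢ|²` for holomorphic functions
`g₁, …, g_r` on a connected open set `U ⊆ ℂⁿ`, not all identically zero: on every compact
`K ⊆ U` there is `ε > 0` with `∫_K (∑ |gᵢ|²)^{-ε} dλ < ∞` (the integrand being `+∞` at
common zeros). -/
theorem exists_integrable_neg_power_of_holomorphic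
    (n : ℕ) (hn : 1 ≤ n)
    (U : Set (Fin n → ℂ)) (hUopen : IsOpen U) (hUconn : IsConnected U)
    (r : ℕ) (g : Fin r → (Fin n → ℂ) → ℂ)
    (hg : ∀ i, DifferentiableOn ℂ (g i) U)
    (hne : ∃ i, ∃ z ∈ U, g i z ≠ 0)
    (K : Set (Fin n → ℂ)) (hKU : K ⊆ U) (hK : IsCompact K) :
    ∃ ε > (0:ℝ),
      ∫⁻ z in K, (ENNReal.ofReal (∑ i, ‖g i z‖ ^ 2)) ^ (-ε) < ⊤ := by
  obtain ⟨i, w, hw, hgw⟩ := hne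
  have hdecay : GeometricSublevelDecay volume (g i) K := by
    refine hK.induction_on (p := GeometricSublevelDecay volume (g i))
      ⟨1, one_pos, 0, by simp, by simp⟩ (fun _ _ hST hT => hT.mono hST)
      (fun _ _ hS hT => hS.union hT) fun a ha => ?_
    obtain ⟨V, hV, hVd⟩ := (hg i).exists_nhds_geometricSublevelDecay (μ := volume) hUopen (hKU ha)
      ((hg i).not_eventuallyEq_zero_of_isPreconnected hUopen hUconn.isPreconnected hw hgw (hKU ha))
    exact ⟨V, mem_nhdsWithin_of_mem_nhds hV, hVd⟩
  obtain ⟨s, hs, hfinite⟩ := hdecay.exists_lintegral_rpow_neg_lt_top hK.measurableSet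
    hK.measure_lt_top.ne ((hg i).continuousOn.mono hKU)
  refine ⟨s / 2, by positivity, lt_of_le_of_lt (lintegral_mono fun z => ?_) hfinite⟩
  calc (ENNReal.ofReal (∑ i, ‖g i z‖ ^ 2)) ^ (-(s / 2))
      ≤ (ENNReal.ofReal (‖g i z‖ ^ 2)) ^ (-(s / 2)) := by
        rw [ENNReal.rpow_neg, ENNReal.rpow_neg]
        gcongr
        exact Finset.single_le_sum (f := fun i => ‖g i z‖ ^ 2) (fun _ _ => by positivity)
          (Finset.mem_univ i)
    _ = ‖g i z‖ₑ ^ (-s) := by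
        rw [ENNReal.ofReal_pow (norm_nonneg _), ofReal_norm, ← ENNReal.rpow_natCast,
          ← ENNReal.rpow_mul]
        congr 1
        push_cast
        ring
end
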